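/- arXiv:math/0403149 — 3 statements merged into one kernel-verified Lean document; each statement's English description precedes it below -/
import Mathlib

section
/- In the setting described, the following identity holds in B: Σ_{k,l=0}^d Y_{kl}* Y_{kl} = 1 + i Σ_{j,k,l=1}^d b^l_{jk} · Y_{j0}* Y_{kl} = 1 − i Σ_{j,k,l=1}^d b^l_{jk} · Y_{kl}* Y_{j0}. -/
open scoped BigOperators

/-- The extended family `X₀, X₁, …, X_d` where `X₀ = i·1`. -/
noncomputable def extX {B : Type*} [Ring B] [Algebra ℂ B] {d : ℕ} (X : Fin d → B) :
    Fin (d + 1) → B :=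
  Fin.cases (Complex.I • (1 : B)) X

/-- The elements `Y_{kl} := X_k X_l Y` for `k, l = 0, …, d`. -/
noncomputable def Ymat {B : Type*} [Ring B] [Algebra ℂ B] {d : ℕ} (X : Fin d → B) (Y : B)
    (k l : Fin (d + 1)) : B :=
  extX X k * extX X l * Y

theorem star_eq_self_of_mul_eq_one {B : Type*} [Ring B] [StarRing B] {A Y : B}
    (hA : star A = A) (hAY : A * Y = 1) : star Y = Y := by
  have h : star Y * A = 1 := by simpa [hA] using congrArg star hAY
  exact left_inv_eq_right_inv h hAY

theorem sum_star_extX_mul_extX {B : Type*} [Ring B] [Algebra ℂ B] [StarRing B] [StarModule ℂ B]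
    {d : ℕ} {X : Fin d → B} (hXstar : ∀ k, star (X k) = - X k) :
    ∑ k, star (extX X k) * extX X k = 1 - ∑ k, X k ^ 2 := by
  simp [extX, Fin.sum_univ_succ, hXstar, smul_smul, pow_two, sub_eq_add_neg]

/-- Commuting `1 - ∑ X_k ^ 2` past `X_l` in a Lie algebra representation. -/
theorem one_sub_sum_sq_mul {B : Type*} [Ring B] [Algebra ℂ B] {d : ℕ}
    {c : Fin d → Fin d → Fin d → ℝ} {X : Fin d → B}
    (hXlie : ∀ i j, X i * X j - X j * X i = ∑ k : Fin d, (c k i j : ℂ) • X k) (l : Fin d) :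
    (1 - ∑ k, X k ^ 2) * X l = X l * (1 - ∑ k, X k ^ 2)
      - ∑ k, ∑ m, (c m k l : ℂ) • (X k * X m + X m * X k) := by
  have h : ∀ k, ∑ m, (c m k l : ℂ) • (X k * X m + X m * X k)
      = X k ^ 2 * X l - X l * X k ^ 2 := by
    intro k
    calc ∑ m, (c m k l : ℂ) • (X k * X m + X m * X k)
        = X k * (∑ m, (c m k l : ℂ) • X m) + (∑ m, (c m k l : ℂ) • X m) * X k := by
          simp only [Finset.mul_sum, Finset.sum_mul, mul_smul_comm, smul_mul_assoc, smul_add,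
            Finset.sum_add_distrib]
      _ = _ := by rw [← hXlie]; noncomm_ring
  simp only [h, Finset.sum_sub_distrib, sub_mul, mul_sub, Finset.sum_mul, Finset.mul_sum, one_mul,
    mul_one]
  abel

theorem sum_structure_smul_mul {B : Type*} [Ring B] [Algebra ℂ B] {d : ℕ}
    {c : Fin d → Fin d → Fin d → ℝ} (hc : ∀ k i j, c k i j = - c k j i) (X : Fin d → B) :
    ∑ j, X j * ∑ k, ∑ m, (c m k j : ℂ) • (X k * X m + X m * X k)
      = - ∑ j, ∑ k, ∑ l, ((c l j k + c k j l : ℝ) : ℂ) • (X j * X k * X l) := by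
  rw [← Finset.sum_neg_distrib]
  refine Finset.sum_congr rfl fun j _ => ?_
  simp only [smul_add, Finset.sum_add_distrib, Complex.ofReal_add, add_smul, mul_add, neg_add,
    Finset.mul_sum, mul_smul_comm, mul_assoc]
  rw [Finset.sum_comm (f := fun k m => (c m k j : ℂ) • (X j * (X m * X k)))]
  simp only [← Finset.sum_neg_distrib, ← neg_smul, ← Complex.ofReal_neg, ← hc]

theorem sum_star_extX_mul_mul_extX {B : Type*} [Ring B] [Algebra ℂ B] [StarRing B]
    [StarModule ℂ B] {d : ℕ} {c : Fin d → Fin d → Fin d → ℝ}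
    (hc : ∀ k i j, c k i j = - c k j i) {X : Fin d → B} (hXstar : ∀ k, star (X k) = - X k)
    (hXlie : ∀ i j, X i * X j - X j * X i = ∑ k : Fin d, (c k i j : ℂ) • X k)
    {A : B} (hA : A = 1 - ∑ k, X k ^ 2) :
    ∑ l, star (extX X l) * A * extX X l
      = A * A - ∑ j, ∑ k, ∑ l, ((c l j k + c k j l : ℝ) : ℂ) • (X j * X k * X l) := by
  have h : ∀ l, star (X l) * A * X l = - X l ^ 2 * A
      + X l * ∑ k, ∑ m, (c m k l : ℂ) • (X k * X m + X m * X k) := by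
    intro l
    have hl := one_sub_sum_sq_mul hXlie l
    rw [← hA] at hl
    rw [hXstar, mul_assoc, hl]
    noncomm_ring
  have h0 : star (extX X 0) * A * extX X 0 = A := by simp [extX, smul_smul]
  have hs : ∀ l : Fin d, extX X l.succ = X l := fun _ => rfl
  rw [Fin.sum_univ_succ, h0]
  simp only [hs, h, Finset.sum_add_distrib]
  rw [sum_structure_smul_mul hc, ← Finset.sum_mul, Finset.sum_neg_distrib,
    show -∑ k, X k ^ 2 = A - 1 by rw [hA]; abel]
  noncomm_ring

/-- In the setting of the paper, relation (r4) holds: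
`Σ_{k,l=0}^d Y_{kl}* Y_{kl} = 1 + i Σ_{j,k,l=1}^d b^l_{jk} Y_{j0}* Y_{kl}
                            = 1 − i Σ_{j,k,l=1}^d b^l_{jk} Y_{kl}* Y_{j0}`,
where `b^l_{jk} = c^l_{jk} + c^k_{jl}`. -/
theorem statement4 {B : Type*} [Ring B] [Algebra ℂ B] [StarRing B] [StarModule ℂ B]
    (d : ℕ) (hd : 1 ≤ d)
    (c : Fin d → Fin d → Fin d → ℝ)
    (hc : ∀ k i j, c k i j = - c k j i)
    (X : Fin d → B)
    (hXstar : ∀ k, star (X k) = - X k)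
    (hXlie : ∀ i j, X i * X j - X j * X i = ∑ k : Fin d, (c k i j : ℂ) • X k)
    (A Y : B) (hA : A = 1 - ∑ k : Fin d, X k ^ 2)
    (hAY : A * Y = 1) (hYA : Y * A = 1) :
    (∑ k : Fin (d + 1), ∑ l : Fin (d + 1), star (Ymat X Y k l) * Ymat X Y k l
        = 1 + Complex.I • ∑ j : Fin d, ∑ k : Fin d, ∑ l : Fin d,
            ((c l j k + c k j l : ℝ) : ℂ) • (star (Ymat X Y j.succ 0) * Ymat X Y k.succ l.succ)) ∧
    (∑ k : Fin (d + 1), ∑ l : Fin (d + 1), star (Ymat X Y k l) * Ymat X Y k l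
        = 1 - Complex.I • ∑ j : Fin d, ∑ k : Fin d, ∑ l : Fin d,
            ((c l j k + c k j l : ℝ) : ℂ) • (star (Ymat X Y k.succ l.succ) * Ymat X Y j.succ 0)) := by
  have hAstar : star A = A := by
    simp [hA, hXstar]
  have hY : star Y = Y := star_eq_self_of_mul_eq_one hAstar hAY
  have hterm : ∀ j k l : Fin d, star (Ymat X Y j.succ 0) * Ymat X Y k.succ l.succ
      = Complex.I • (Y * (X j * X k * X l) * Y) := by
    intro j k l
    simp [Ymat, extX, hXstar, hY, mul_assoc]
  have hsum : ∑ k : Fin (d + 1), ∑ l : Fin (d + 1), star (Ymat X Y k l) * Ymat X Y k l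
      = Y * (∑ l, star (extX X l) * A * extX X l) * Y := by
    rw [Finset.sum_comm, hA, ← sum_star_extX_mul_extX hXstar]
    simp only [Finset.mul_sum, Finset.sum_mul, Ymat, star_mul, hY, mul_assoc]
  have hfirst : ∑ k : Fin (d + 1), ∑ l : Fin (d + 1), star (Ymat X Y k l) * Ymat X Y k l
      = 1 + Complex.I • ∑ j : Fin d, ∑ k : Fin d, ∑ l : Fin d,
          ((c l j k + c k j l : ℝ) : ℂ) •
            (star (Ymat X Y j.succ 0) * Ymat X Y k.succ l.succ) := by
    have hone : Y * (A * A) * Y = 1 := by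
      rw [← mul_assoc, hYA, one_mul, hAY]
    rw [hsum, sum_star_extX_mul_mul_extX hc hXstar hXlie hA, mul_sub, sub_mul, hone,
      sub_eq_add_neg]
    have hI : ∀ r : ℂ, Complex.I * (r * Complex.I) = -r := fun r => by
      rw [mul_left_comm, Complex.I_mul_I, mul_neg_one]
    simp only [hterm, Finset.smul_sum, smul_smul, hI, neg_smul, Finset.sum_neg_distrib,
      Finset.mul_sum, Finset.sum_mul, mul_smul_comm, smul_mul_assoc]
  refine ⟨hfirst, ?_⟩
  have hstar := congrArg star hfirst
  simpa only [star_sum, star_add, star_one, star_smul, star_mul, star_star, Complex.star_def,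
    Complex.conj_I, Complex.conj_ofReal, neg_smul, ← sub_eq_add_neg] using hstar
end

section
/- In the setting described, for all i, j, k, l ∈ {1,…,d} the elements Y_{kl}·Y_{ij} − Y_{ij}·Y_{kl} and Y_{kl}·Y_{ij} − Y_{ki}·Y_{lj} belong to the ideal 𝒳₀. -/
open scoped BigOperators

/-- The *-algebra `𝒳`: the unital subalgebra of `B` generated by all elements
`X_k X_l Y` and `Y X_l X_k` with `k, l = 0, …, d`. -/
noncomputable def scriptX {B : Type*} [Ring B] [Algebra ℂ B] {d : ℕ} (X : Fin d → B) (Y : B) :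
    Subalgebra ℂ B :=
  Algebra.adjoin ℂ
    {b : B | ∃ k l : Fin (d + 1), b = extX X k * extX X l * Y ∨ b = Y * (extX X l * extX X k)}

/-- The two-sided ideal `𝒳₀` of `𝒳` generated by the elements `X_k Y` and `Y X_k`,
`k = 0, …, d`: its elements are the finite sums of products `x · g · z` with
`x, z ∈ 𝒳` and `g` one of the generators. -/
noncomputable def scriptX0 {B : Type*} [Ring B] [Algebra ℂ B] {d : ℕ} (X : Fin d → B) (Y : B) :
    AddSubgroup B :=
  AddSubgroup.closure
    {b : B | ∃ x ∈ scriptX X Y, ∃ z ∈ scriptX X Y, ∃ k : Fin (d + 1),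
      b = x * (extX X k * Y) * z ∨ b = x * (Y * extX X k) * z}

section ScriptX

variable {B : Type*} [Ring B] [Algebra ℂ B] {d : ℕ} {X : Fin d → B} {A Y : B}

theorem Ymat_succ_succ (k l : Fin d) : Ymat X Y k.succ l.succ = X k * X l * Y := rfl

theorem mul_mul_mem_scriptX (k l : Fin d) : X k * X l * Y ∈ scriptX X Y :=
  Algebra.subset_adjoin ⟨k.succ, l.succ, Or.inl rfl⟩

theorem mul_mem_scriptX0 (k : Fin d) : X k * Y ∈ scriptX0 X Y :=
  AddSubgroup.subset_closure
    ⟨1, one_mem _, 1, one_mem _, k.succ, Or.inl (by rw [one_mul, mul_one]; rfl)⟩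

theorem scriptX0_mul_mem_left {a b : B} (ha : a ∈ scriptX X Y) (hb : b ∈ scriptX0 X Y) :
    a * b ∈ scriptX0 X Y := by
  induction hb using AddSubgroup.closure_induction with
  | mem b hb =>
    obtain ⟨x, hx, z, hz, k, h⟩ := hb
    refine AddSubgroup.subset_closure ⟨a * x, mul_mem ha hx, z, hz, k, ?_⟩
    rcases h with rfl | rfl
    · exact Or.inl (by simp only [mul_assoc])
    · exact Or.inr (by simp only [mul_assoc])
  | zero => rw [mul_zero]; exact zero_mem _
  | add b b' _ _ h h' => rw [mul_add]; exact add_mem h h'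
  | neg b _ h => rw [mul_neg]; exact neg_mem h

theorem scriptX0_mul_mem_right {a b : B} (hb : b ∈ scriptX0 X Y) (ha : a ∈ scriptX X Y) :
    b * a ∈ scriptX0 X Y := by
  induction hb using AddSubgroup.closure_induction with
  | mem b hb =>
    obtain ⟨x, hx, z, hz, k, h⟩ := hb
    refine AddSubgroup.subset_closure ⟨x, hx, z * a, mul_mem hz ha, k, ?_⟩
    rcases h with rfl | rfl
    · exact Or.inl (by simp only [mul_assoc])
    · exact Or.inr (by simp only [mul_assoc])
  | zero => rw [zero_mul]; exact zero_mem _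
  | add b b' _ _ h h' => rw [add_mul]; exact add_mem h h'
  | neg b _ h => rw [neg_mul]; exact neg_mem h

theorem scriptX0_smul_mem (a : ℂ) {b : B} (hb : b ∈ scriptX0 X Y) : a • b ∈ scriptX0 X Y := by
  rw [Algebra.smul_def]
  exact scriptX0_mul_mem_left (Subalgebra.algebraMap_mem _ a) hb

variable {c : Fin d → Fin d → Fin d → ℝ}

theorem Ymat_sub_swap_mem_scriptX0
    (hX : ∀ i j, X i * X j - X j * X i = ∑ k : Fin d, (c k i j : ℂ) • X k) (k l : Fin d) :
    Ymat X Y k.succ l.succ - Ymat X Y l.succ k.succ ∈ scriptX0 X Y := by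
  rw [Ymat_succ_succ, Ymat_succ_succ, ← sub_mul, hX, Finset.sum_mul]
  refine sum_mem fun m _ => ?_
  rw [smul_mul_assoc]
  exact scriptX0_smul_mem _ (mul_mem_scriptX0 m)

theorem mul_commutator_mul_mem_scriptX
    (hX : ∀ i j, X i * X j - X j * X i = ∑ k : Fin d, (c k i j : ℂ) • X k) (k l i : Fin d) :
    X k * (X l * X i - X i * X l) * Y ∈ scriptX X Y := by
  rw [hX, Finset.mul_sum, Finset.sum_mul]
  refine sum_mem fun m _ => ?_
  rw [mul_smul_comm, smul_mul_assoc]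
  exact Subalgebra.smul_mem _ (mul_mul_mem_scriptX k m) _

theorem commutator_mul_mul_mem_scriptX
    (hX : ∀ i j, X i * X j - X j * X i = ∑ k : Fin d, (c k i j : ℂ) • X k) (k l i : Fin d) :
    (X l * X i - X i * X l) * X k * Y ∈ scriptX X Y := by
  rw [hX, Finset.sum_mul, Finset.sum_mul]
  refine sum_mem fun m _ => ?_
  rw [smul_mul_assoc, smul_mul_assoc]
  exact Subalgebra.smul_mem _ (mul_mul_mem_scriptX m k) _

theorem commutator_laplacian_mul_mem_scriptX
    (hX : ∀ i j, X i * X j - X j * X i = ∑ k : Fin d, (c k i j : ℂ) • X k)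
    (hA : A = 1 - ∑ k : Fin d, X k ^ 2) (i : Fin d) :
    (A * X i - X i * A) * Y ∈ scriptX X Y := by
  have h : (A * X i - X i * A) * Y = -∑ k : Fin d,
      (X k * (X k * X i - X i * X k) * Y + (X k * X i - X i * X k) * X k * Y) := by
    have h' : ∀ k, X k * (X k * X i - X i * X k) * Y + (X k * X i - X i * X k) * X k * Y
        = (X k ^ 2 * X i - X i * X k ^ 2) * Y := fun k => by noncomm_ring
    simp_rw [h', ← Finset.sum_mul, Finset.sum_sub_distrib, ← Finset.sum_mul, ← Finset.mul_sum]
    rw [hA]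
    noncomm_ring
  rw [h]
  exact neg_mem (sum_mem fun k _ => add_mem (mul_commutator_mul_mem_scriptX hX k k i)
    (commutator_mul_mul_mem_scriptX hX k k i))

theorem Ymat_mul_sub_swap_middle_mem_scriptX0
    (hX : ∀ i j, X i * X j - X j * X i = ∑ k : Fin d, (c k i j : ℂ) • X k)
    (hA : A = 1 - ∑ k : Fin d, X k ^ 2) (hAY : A * Y = 1) (hYA : Y * A = 1)
    (k l i j : Fin d) :
    Ymat X Y k.succ l.succ * Ymat X Y i.succ j.succ
      - Ymat X Y k.succ i.succ * Ymat X Y l.succ j.succ ∈ scriptX0 X Y := by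
  have hY : ∀ m, Y * X m = X m * Y - Y * ((A * X m - X m * A) * Y) := fun m => by
    have h : Y * ((A * X m - X m * A) * Y) = (Y * A) * X m * Y - Y * X m * (A * Y) := by
      noncomm_ring
    rw [h, hAY, hYA, one_mul, mul_one, sub_sub_cancel]
  have h : Ymat X Y k.succ l.succ * Ymat X Y i.succ j.succ
      - Ymat X Y k.succ i.succ * Ymat X Y l.succ j.succ
      = (X k * (X l * X i - X i * X l) * Y - X k * X l * Y * ((A * X i - X i * A) * Y)
        + X k * X i * Y * ((A * X l - X l * A) * Y)) * (X j * Y) := by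
    calc _ = (X k * X l * (Y * X i) - X k * X i * (Y * X l)) * (X j * Y) := by
          simp only [Ymat_succ_succ]
          noncomm_ring
      _ = _ := by
          rw [hY i, hY l]
          noncomm_ring
  rw [h]
  refine scriptX0_mul_mem_left (add_mem (sub_mem (mul_commutator_mul_mem_scriptX hX k l i) ?_) ?_)
    (mul_mem_scriptX0 j)
  · exact mul_mem (mul_mul_mem_scriptX k l) (commutator_laplacian_mul_mem_scriptX hX hA i)
  · exact mul_mem (mul_mul_mem_scriptX k i) (commutator_laplacian_mul_mem_scriptX hX hA l)

end ScriptX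

/-- For all `i, j, k, l ∈ {1,…,d}` the elements
`Y_{kl} Y_{ij} − Y_{ij} Y_{kl}` and `Y_{kl} Y_{ij} − Y_{ki} Y_{lj}` belong to `𝒳₀`. -/
theorem statement6 {B : Type*} [Ring B] [Algebra ℂ B] [StarRing B] [StarModule ℂ B]
    (d : ℕ) (hd : 1 ≤ d)
    (c : Fin d → Fin d → Fin d → ℝ)
    (hc : ∀ k i j, c k i j = - c k j i)
    (X : Fin d → B)
    (hXstar : ∀ k, star (X k) = - X k)
    (hXlie : ∀ i j, X i * X j - X j * X i = ∑ k : Fin d, (c k i j : ℂ) • X k)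
    (A Y : B) (hA : A = 1 - ∑ k : Fin d, X k ^ 2)
    (hAY : A * Y = 1) (hYA : Y * A = 1) :
    ∀ i j k l : Fin d,
      Ymat X Y k.succ l.succ * Ymat X Y i.succ j.succ
          - Ymat X Y i.succ j.succ * Ymat X Y k.succ l.succ ∈ scriptX0 X Y ∧
      Ymat X Y k.succ l.succ * Ymat X Y i.succ j.succ
          - Ymat X Y k.succ i.succ * Ymat X Y l.succ j.succ ∈ scriptX0 X Y := by
  intro i j k l
  have hswap := Ymat_mul_sub_swap_middle_mem_scriptX0 hXlie hA hAY hYA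
  refine ⟨?_, hswap k l i j⟩
  have hki := scriptX0_mul_mem_right (Ymat_sub_swap_mem_scriptX0 (Y := Y) hXlie k i)
    (mul_mul_mem_scriptX l j)
  have hlj := scriptX0_mul_mem_left (mul_mul_mem_scriptX i k)
    (Ymat_sub_swap_mem_scriptX0 (Y := Y) hXlie l j)
  rw [← Ymat_succ_succ, sub_mul] at hki
  rw [← Ymat_succ_succ, mul_sub] at hlj
  have h := add_mem (add_mem (hswap k l i j) hki) (add_mem hlj (hswap i k j l))
  simpa only [sub_add_sub_cancel] using h
end

section
/- In the setting described, for every n ∈ ℕ, n ≥ 1, and all indices k₁, …, k_{4n} ∈ {0,…,d}, the element Yⁿ · X_{k₁} ⋯ X_{k_{4n}} · Yⁿ − Y_{k₁k₂} · Y_{k₃k₄} ⋯ Y_{k_{4n-1}k_{4n}} belongs to the ideal 𝒳₀. -/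
open scoped BigOperators

lemma mul_resolvent_eq {B : Type*} [Ring B] {A Y : B} (hAY : A * Y = 1) (hYA : Y * A = 1)
    (w : B) :
    w * Y = Y * w + Y * (A * w - w * A) * Y := by
  have h1 : Y * (A * w) * Y = w * Y := by rw [← mul_assoc, hYA, one_mul]
  have h2 : Y * (w * A) * Y = Y * w := by rw [mul_assoc, mul_assoc w, hAY, mul_one]
  rw [mul_sub, sub_mul, h1, h2]
  abel

lemma mul_pow_resolvent_sub {B : Type*} [Ring B] {A Y : B} (hAY : A * Y = 1) (hYA : Y * A = 1)
    (a b w : B) (n : ℕ) :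
    a * b * w * Y ^ (n + 1) - a * b * Y * (w * Y ^ n) =
      a * b * Y * ((A * w - w * A) * Y ^ (n + 1)) := by
  have h : w * Y ^ (n + 1) = Y * (w * Y ^ n) + Y * ((A * w - w * A) * Y ^ (n + 1)) := by
    rw [pow_succ', ← mul_assoc, mul_resolvent_eq hAY hYA w]
    noncomm_ring
  rw [mul_assoc (a * b), h, mul_add]
  simp only [mul_assoc]
  abel

lemma star_resolvent {B : Type*} [Ring B] [StarRing B] {d : ℕ} {X : Fin d → B} {A Y : B}
    (hX : ∀ k, star (X k) = -X k) (hA : A = 1 - ∑ k : Fin d, X k ^ 2)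
    (hYA : Y * A = 1) : star Y = Y := by
  have hsA : star A = A := by simp [hA, star_sum, hX]
  have h : A * star Y = 1 := by rw [← hsA, ← star_mul, hYA, star_one]
  exact (left_inv_eq_right_inv hYA h).symm

section ResolventAlgebra

variable {B : Type*} [Ring B] [Algebra ℂ B] {d : ℕ} {X : Fin d → B} {A Y : B}

@[simp] lemma extX_zero : extX X 0 = Complex.I • (1 : B) := rfl

@[simp] lemma extX_succ (j : Fin d) : extX X j.succ = X j := rfl

/-- The linear span of `X₀, …, X_d`. -/
noncomputable def spanX (X : Fin d → B) : Submodule ℂ B :=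
  Submodule.span ℂ (Set.range (extX X))

lemma extX_mem_spanX (k : Fin (d + 1)) : extX X k ∈ spanX X :=
  Submodule.subset_span ⟨k, rfl⟩

lemma mem_spanX (j : Fin d) : X j ∈ spanX X :=
  extX_mem_spanX (X := X) j.succ

lemma one_mem_spanX : (1 : B) ∈ spanX X := by
  have h := (spanX X).smul_mem (-Complex.I) (extX_mem_spanX (X := X) 0)
  simpa [smul_smul] using h

lemma mul_mul_mem_scriptX_s11 {a b : B} (ha : a ∈ spanX X) (hb : b ∈ spanX X) :
    a * b * Y ∈ scriptX X Y := by
  induction ha using Submodule.span_induction with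
  | mem a ha =>
    obtain ⟨k, rfl⟩ := ha
    induction hb using Submodule.span_induction with
    | mem b hb =>
      obtain ⟨l, rfl⟩ := hb
      exact Algebra.subset_adjoin ⟨k, l, Or.inl rfl⟩
    | zero => simp
    | add b c _ _ hb hc => simpa [mul_add, add_mul] using add_mem hb hc
    | smul r b _ hb => simpa using Subalgebra.smul_mem _ hb r
  | zero => simp
  | add a c _ _ ha hc => simpa [add_mul] using add_mem ha hc
  | smul r a _ ha => simpa using Subalgebra.smul_mem _ ha r

lemma mul_mem_scriptX {a : B} (ha : a ∈ spanX X) : a * Y ∈ scriptX X Y := by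
  simpa using mul_mul_mem_scriptX_s11 (Y := Y) ha one_mem_spanX

lemma resolvent_mem_scriptX : Y ∈ scriptX X Y := by
  simpa using mul_mem_scriptX (X := X) (Y := Y) one_mem_spanX

lemma mul_extX_mem_scriptX (k : Fin (d + 1)) : Y * extX X k ∈ scriptX X Y := by
  have h : Y * (extX X k * extX X 0) ∈ scriptX X Y :=
    Algebra.subset_adjoin ⟨0, k, Or.inr rfl⟩
  simpa [smul_smul] using Subalgebra.smul_mem _ h (-Complex.I)

lemma mul_mem_scriptX0_left {s x : B} (hs : s ∈ scriptX X Y) (hx : x ∈ scriptX0 X Y) :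
    s * x ∈ scriptX0 X Y := by
  induction hx using AddSubgroup.closure_induction with
  | mem x hx =>
    obtain ⟨u, hu, z, hz, k, rfl | rfl⟩ := hx
    · exact AddSubgroup.subset_closure
        ⟨s * u, mul_mem hs hu, z, hz, k, Or.inl (by simp only [mul_assoc])⟩
    · exact AddSubgroup.subset_closure
        ⟨s * u, mul_mem hs hu, z, hz, k, Or.inr (by simp only [mul_assoc])⟩
  | zero => simp
  | add x y _ _ hx hy => simpa [mul_add] using add_mem hx hy
  | neg x _ hx => simpa using hx

lemma mul_mem_scriptX0_right {s x : B} (hs : s ∈ scriptX X Y) (hx : x ∈ scriptX0 X Y) :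
    x * s ∈ scriptX0 X Y := by
  induction hx using AddSubgroup.closure_induction with
  | mem x hx =>
    obtain ⟨u, hu, z, hz, k, rfl | rfl⟩ := hx
    · exact AddSubgroup.subset_closure
        ⟨u, hu, z * s, mul_mem hz hs, k, Or.inl (by simp only [mul_assoc])⟩
    · exact AddSubgroup.subset_closure
        ⟨u, hu, z * s, mul_mem hz hs, k, Or.inr (by simp only [mul_assoc])⟩
  | zero => simp
  | add x y _ _ hx hy => simpa [add_mul] using add_mem hx hy
  | neg x _ hx => simpa using hx

lemma scriptX0_smul_mem_s11 (r : ℂ) {x : B} (hx : x ∈ scriptX0 X Y) : r • x ∈ scriptX0 X Y := by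
  simpa using mul_mem_scriptX0_left (Subalgebra.smul_mem _ (one_mem (scriptX X Y)) r) hx

lemma scriptX0_subset_scriptX {x : B} (hx : x ∈ scriptX0 X Y) : x ∈ scriptX X Y := by
  induction hx using AddSubgroup.closure_induction with
  | mem x hx =>
    obtain ⟨u, hu, z, hz, k, rfl | rfl⟩ := hx
    · exact mul_mem (mul_mem hu (mul_mem_scriptX (extX_mem_spanX k))) hz
    · exact mul_mem (mul_mem hu (mul_extX_mem_scriptX k)) hz
  | zero => exact zero_mem _
  | add x y _ _ hx hy => exact add_mem hx hy
  | neg x _ hx => exact neg_mem hx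

lemma mul_mem_scriptX0_s11 {a : B} (ha : a ∈ spanX X) : a * Y ∈ scriptX0 X Y := by
  induction ha using Submodule.span_induction with
  | mem a ha =>
    obtain ⟨k, rfl⟩ := ha
    exact AddSubgroup.subset_closure
      ⟨1, one_mem _, 1, one_mem _, k, Or.inl (by rw [one_mul, mul_one])⟩
  | zero => simp
  | add a c _ _ ha hc => simpa [add_mul] using add_mem ha hc
  | smul r a _ ha => simpa using scriptX0_smul_mem_s11 r ha

lemma commutator_extX_mem {c : Fin d → Fin d → Fin d → ℝ}
    (hXlie : ∀ i j, X i * X j - X j * X i = ∑ k : Fin d, (c k i j : ℂ) • X k)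
    (hA : A = 1 - ∑ k : Fin d, X k ^ 2) (k : Fin (d + 1)) :
    A * extX X k - extX X k * A ∈ spanX X ^ 2 := by
  induction k using Fin.cases with
  | zero => simp
  | succ j =>
    have hlie : ∀ i, X i * X j - X j * X i ∈ spanX X := fun i => by
      rw [hXlie]
      exact Submodule.sum_mem _ fun k _ => Submodule.smul_mem _ _ (mem_spanX k)
    have key : A * extX X j.succ - extX X j.succ * A =
        -∑ i, (X i * (X i * X j - X j * X i) + (X i * X j - X j * X i) * X i) := by
      rw [hA, extX_succ, sub_mul, mul_sub, Finset.sum_mul, Finset.mul_sum, one_mul, mul_one,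
        sub_sub_sub_cancel_left, ← Finset.sum_sub_distrib, ← Finset.sum_neg_distrib]
      exact Finset.sum_congr rfl fun i _ => by noncomm_ring
    rw [key, pow_two]
    exact neg_mem (Submodule.sum_mem _ fun i _ => add_mem
      (Submodule.mul_mem_mul (mem_spanX i) (hlie i))
      (Submodule.mul_mem_mul (hlie i) (mem_spanX i)))

lemma commutator_mem_pow (hV : ∀ k, A * extX X k - extX X k * A ∈ spanX X ^ 2) (m : ℕ)
    {w : B} (hw : w ∈ spanX X ^ m) : A * w - w * A ∈ spanX X ^ (m + 1) := by
  induction m generalizing w with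
  | zero =>
    rw [pow_zero, Submodule.mem_one] at hw
    obtain ⟨r, rfl⟩ := hw
    rw [Algebra.commutes, sub_self]
    exact zero_mem _
  | succ m ih =>
    rw [pow_succ] at hw
    induction hw using Submodule.mul_induction_on' with
    | mem_mul_mem u hu v hv =>
      have hv' : A * v - v * A ∈ spanX X ^ 2 := by
        induction hv using Submodule.span_induction with
        | mem v hv =>
          obtain ⟨k, rfl⟩ := hv
          exact hV k
        | zero => simp
        | add a b _ _ ha hb =>
          convert add_mem ha hb using 1
          noncomm_ring
        | smul r a _ ha => simpa [smul_sub] using Submodule.smul_mem _ r ha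
      have key : A * (u * v) - u * v * A = (A * u - u * A) * v + u * (A * v - v * A) := by
        noncomm_ring
      rw [key]
      refine add_mem ?_ ?_
      · rw [pow_succ]
        exact Submodule.mul_mem_mul (ih hu) hv
      · rw [add_assoc, pow_add]
        exact Submodule.mul_mem_mul hu hv'
    | add a _ b _ ha hb =>
      convert add_mem ha hb using 1
      noncomm_ring

lemma mul_pow_mem_scriptX0 (hV : ∀ k, A * extX X k - extX X k * A ∈ spanX X ^ 2)
    (hAY : A * Y = 1) (hYA : Y * A = 1) (m : ℕ) :
    ∀ n, m < 2 * n → ∀ w ∈ spanX X ^ m, w * Y ^ n ∈ scriptX0 X Y := by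
  induction m using Nat.strong_induction_on with
  | _ m ih =>
    rintro (_ | n) hn w hw
    · omega
    have hone : ∀ v ∈ spanX X, v * Y ^ (n + 1) ∈ scriptX0 X Y := fun v hv => by
      rw [pow_succ', ← mul_assoc]
      exact mul_mem_scriptX0_right (pow_mem resolvent_mem_scriptX n) (mul_mem_scriptX0_s11 hv)
    match m with
    | 0 =>
      rw [pow_zero] at hw
      exact hone w (Submodule.one_le.mpr one_mem_spanX hw)
    | 1 => exact hone w (by rwa [pow_one] at hw)
    | m + 2 =>
      rw [pow_succ', pow_succ', ← mul_assoc] at hw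
      induction hw using Submodule.mul_induction_on' with
      | mem_mul_mem ab hab w hw =>
        induction hab using Submodule.mul_induction_on' with
        | mem_mul_mem a ha b hb =>
          rw [← sub_add_cancel (a * b * w * Y ^ (n + 1)) (a * b * Y * (w * Y ^ n)),
            mul_pow_resolvent_sub hAY hYA]
          have hab := mul_mul_mem_scriptX_s11 (Y := Y) ha hb
          exact add_mem
            (mul_mem_scriptX0_left hab
              (ih (m + 1) (by omega) _ (by omega) _ (commutator_mem_pow hV m hw)))
            (mul_mem_scriptX0_left hab (ih m (by omega) n (by omega) w hw))
        | add a _ b _ ha hb => simpa [add_mul] using add_mem ha hb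
      | add a _ b _ ha hb => simpa [add_mul] using add_mem ha hb

lemma mul_pow_congr (hV : ∀ k, A * extX X k - extX X k * A ∈ spanX X ^ 2)
    (hAY : A * Y = 1) (hYA : Y * A = 1) {m n : ℕ} (hmn : m ≤ 2 * n) {a b w : B}
    (ha : a ∈ spanX X) (hb : b ∈ spanX X) (hw : w ∈ spanX X ^ m) :
    a * b * w * Y ^ (n + 1) - a * b * Y * (w * Y ^ n) ∈ scriptX0 X Y := by
  rw [mul_pow_resolvent_sub hAY hYA]
  exact mul_mem_scriptX0_left (mul_mul_mem_scriptX_s11 ha hb)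
    (mul_pow_mem_scriptX0 hV hAY hYA (m + 1) _ (by omega) _ (commutator_mem_pow hV m hw))

lemma mul_commutator_resolvent_mem (hV : ∀ k, A * extX X k - extX X k * A ∈ spanX X ^ 2)
    (hAY : A * Y = 1) (hYA : Y * A = 1) {a b : B} (ha : a ∈ spanX X) (hb : b ∈ spanX X) :
    a * (b * Y - Y * b) ∈ scriptX0 X Y := by
  have hq : ∀ q ∈ spanX X ^ 2, q * Y ∈ scriptX X Y := fun q hq => by
    rw [pow_two] at hq
    induction hq using Submodule.mul_induction_on' with
    | mem_mul_mem u hu v hv => exact mul_mul_mem_scriptX_s11 hu hv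
    | add u _ v _ hu hv => simpa [add_mul] using add_mem hu hv
  rw [mul_resolvent_eq hAY hYA b, add_sub_cancel_left, mul_assoc Y, ← mul_assoc a]
  exact mul_mem_scriptX0_right (hq _ (commutator_mem_pow hV 1 (by rwa [pow_one])))
    (mul_mem_scriptX0_s11 ha)

section Star

variable [StarRing B] [StarModule ℂ B]

lemma star_extX (hX : ∀ k, star (X k) = -X k) (k : Fin (d + 1)) :
    star (extX X k) = -extX X k := by
  induction k using Fin.cases with
  | zero => simp [star_smul]
  | succ j => exact hX j

lemma star_mem_pow (hX : ∀ k, star (X k) = -X k) (m : ℕ) {w : B} (hw : w ∈ spanX X ^ m) :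
    star w ∈ spanX X ^ m := by
  induction m generalizing w with
  | zero =>
    rw [pow_zero, Submodule.mem_one] at hw ⊢
    obtain ⟨r, rfl⟩ := hw
    exact ⟨star r, algebraMap_star_comm r⟩
  | succ m ih =>
    rw [pow_succ] at hw
    rw [pow_succ']
    induction hw using Submodule.mul_induction_on' with
    | mem_mul_mem u hu v hv =>
      rw [star_mul]
      refine Submodule.mul_mem_mul ?_ (ih hu)
      induction hv using Submodule.span_induction with
      | mem v hv =>
        obtain ⟨k, rfl⟩ := hv
        rw [star_extX hX]
        exact neg_mem (extX_mem_spanX k)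
      | zero => simp
      | add a b _ _ ha hb => simpa using add_mem ha hb
      | smul r a _ ha => simpa [star_smul] using Submodule.smul_mem _ (star r) ha
    | add a _ b _ ha hb => simpa using add_mem ha hb

lemma star_mem_scriptX (hX : ∀ k, star (X k) = -X k) (hY : star Y = Y) {x : B}
    (hx : x ∈ scriptX X Y) : star x ∈ scriptX X Y := by
  induction hx using Algebra.adjoin_induction with
  | mem x hx =>
    obtain ⟨k, l, rfl | rfl⟩ := hx
    · exact Algebra.subset_adjoin ⟨k, l, Or.inr (by simp [star_extX hX, hY])⟩
    · exact Algebra.subset_adjoin ⟨k, l, Or.inl (by simp [star_extX hX, hY])⟩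
  | algebraMap r =>
    rw [← algebraMap_star_comm]
    exact Subalgebra.algebraMap_mem _ _
  | add x y _ _ hx hy => simpa using add_mem hx hy
  | mul x y _ _ hx hy => simpa using mul_mem hy hx

lemma star_mem_scriptX0 (hX : ∀ k, star (X k) = -X k) (hY : star Y = Y) {x : B}
    (hx : x ∈ scriptX0 X Y) : star x ∈ scriptX0 X Y := by
  induction hx using AddSubgroup.closure_induction with
  | mem x hx =>
    obtain ⟨u, hu, z, hz, k, rfl | rfl⟩ := hx
    · exact AddSubgroup.subset_closure
        ⟨-star z, neg_mem (star_mem_scriptX hX hY hz), star u, star_mem_scriptX hX hY hu, k,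
          Or.inr (by simp [star_extX hX, hY, mul_assoc])⟩
    · exact AddSubgroup.subset_closure
        ⟨-star z, neg_mem (star_mem_scriptX hX hY hz), star u, star_mem_scriptX hX hY hu, k,
          Or.inl (by simp [star_extX hX, hY, mul_assoc])⟩
  | zero => simp
  | add x y _ _ hx hy => simpa using add_mem hx hy
  | neg x _ hx => simpa using hx

lemma star_mem_spanX (hX : ∀ k, star (X k) = -X k) {v : B} (hv : v ∈ spanX X) :
    star v ∈ spanX X := by
  simpa using star_mem_pow hX 1 (w := v) (by simpa using hv)

lemma mul_mul_resolvent_congr (hX : ∀ k, star (X k) = -X k) (hY : star Y = Y)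
    (hV : ∀ k, A * extX X k - extX X k * A ∈ spanX X ^ 2)
    (hAY : A * Y = 1) (hYA : Y * A = 1) {a b : B} (ha : a ∈ spanX X) (hb : b ∈ spanX X) :
    Y * (a * b) - a * b * Y ∈ scriptX0 X Y := by
  have h1 := mul_commutator_resolvent_mem hV hAY hYA ha hb
  have h2 := star_mem_scriptX0 hX hY (mul_commutator_resolvent_mem hV hAY hYA
    (star_mem_spanX hX hb) (star_mem_spanX hX ha))
  simp only [star_mul, star_sub, star_star, hY] at h2
  convert sub_mem h2 h1 using 1
  noncomm_ring

lemma pow_mul_congr (hX : ∀ k, star (X k) = -X k) (hY : star Y = Y)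
    (hV : ∀ k, A * extX X k - extX X k * A ∈ spanX X ^ 2)
    (hAY : A * Y = 1) (hYA : Y * A = 1) {m n : ℕ} (hmn : m ≤ 2 * n) {a b w : B}
    (ha : a ∈ spanX X) (hb : b ∈ spanX X) (hw : w ∈ spanX X ^ m) :
    Y ^ (n + 1) * (w * (a * b)) - Y ^ n * w * (Y * (a * b)) ∈ scriptX0 X Y := by
  have h := star_mem_scriptX0 hX hY
    (mul_pow_congr hV hAY hYA hmn (star_mem_spanX hX hb) (star_mem_spanX hX ha)
      (star_mem_pow hX m hw))
  simpa [hY, mul_assoc] using h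

end Star

/-- The product of the `X_k X_l` over a list of pairs of indices. -/
noncomputable def pairProd (X : Fin d → B) (L : List (Fin (d + 1) × Fin (d + 1))) : B :=
  (L.map fun p => extX X p.1 * extX X p.2).prod

/-- The product of the `Y_{kl}` over a list of pairs of indices. -/
noncomputable def pairProdY (X : Fin d → B) (Y : B)
    (L : List (Fin (d + 1) × Fin (d + 1))) : B :=
  (L.map fun p => Ymat X Y p.1 p.2).prod

lemma pairProd_mem_pow (L : List (Fin (d + 1) × Fin (d + 1))) :
    pairProd X L ∈ spanX X ^ (2 * L.length) := by
  induction L with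
  | nil => exact Submodule.one_le.mp le_rfl
  | cons p L ih =>
    rw [List.length_cons, mul_add, mul_one, add_comm, pow_add, pow_two]
    exact Submodule.mul_mem_mul
      (Submodule.mul_mem_mul (extX_mem_spanX p.1) (extX_mem_spanX p.2)) ih

lemma pairProdY_mem_scriptX (L : List (Fin (d + 1) × Fin (d + 1))) :
    pairProdY X Y L ∈ scriptX X Y :=
  list_prod_mem fun x hx => by
    obtain ⟨p, -, rfl⟩ := List.mem_map.mp hx
    exact mul_mul_mem_scriptX_s11 (extX_mem_spanX p.1) (extX_mem_spanX p.2)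

lemma pairProd_mul_pow_congr (hV : ∀ k, A * extX X k - extX X k * A ∈ spanX X ^ 2)
    (hAY : A * Y = 1) (hYA : Y * A = 1) (L : List (Fin (d + 1) × Fin (d + 1))) :
    pairProd X L * Y ^ L.length - pairProdY X Y L ∈ scriptX0 X Y := by
  induction L with
  | nil => simp [pairProd, pairProdY]
  | cons p L ih =>
    have h1 := mul_pow_congr hV hAY hYA le_rfl (extX_mem_spanX p.1) (extX_mem_spanX p.2)
      (pairProd_mem_pow (X := X) L)
    have h2 := mul_mem_scriptX0_left
      (mul_mul_mem_scriptX_s11 (Y := Y) (extX_mem_spanX p.1) (extX_mem_spanX p.2)) ih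
    rw [mul_sub] at h2
    simpa [pairProd, pairProdY, Ymat] using add_mem h1 h2

lemma pow_mul_pairProd_congr [StarRing B] [StarModule ℂ B] (hX : ∀ k, star (X k) = -X k)
    (hY : star Y = Y) (hV : ∀ k, A * extX X k - extX X k * A ∈ spanX X ^ 2)
    (hAY : A * Y = 1) (hYA : Y * A = 1) (L : List (Fin (d + 1) × Fin (d + 1))) :
    Y ^ L.length * pairProd X L - pairProdY X Y L ∈ scriptX0 X Y := by
  induction L using List.reverseRecOn with
  | nil => simp [pairProd, pairProdY]
  | append_singleton L p ih =>
    have hYp : Y * (extX X p.1 * extX X p.2) ∈ scriptX X Y :=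
      Algebra.subset_adjoin ⟨p.2, p.1, Or.inr rfl⟩
    have h1 := pow_mul_congr hX hY hV hAY hYA le_rfl (extX_mem_spanX p.1)
      (extX_mem_spanX p.2) (pairProd_mem_pow (X := X) L)
    have h2 := mul_mem_scriptX0_right hYp ih
    have h3 := mul_mul_resolvent_congr hX hY hV hAY hYA (extX_mem_spanX p.1)
      (extX_mem_spanX p.2)
    have h4 := mul_mem_scriptX0_left (pairProdY_mem_scriptX (X := X) (Y := Y) L) h3
    rw [sub_mul] at h2
    rw [mul_sub] at h4
    have h := add_mem (add_mem h1 h2) h4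
    simpa [pairProd, pairProdY, Ymat] using h

end ResolventAlgebra

/-- For every `n ≥ 1` and all indices `k₁, …, k_{4n} ∈ {0,…,d}`, the
element `Yⁿ X_{k₁} ⋯ X_{k_{4n}} Yⁿ − Y_{k₁k₂} Y_{k₃k₄} ⋯ Y_{k_{4n-1}k_{4n}}` belongs to
the ideal `𝒳₀`. -/
theorem statement11 {B : Type*} [Ring B] [Algebra ℂ B] [StarRing B] [StarModule ℂ B]
    (d : ℕ) (hd : 1 ≤ d)
    (c : Fin d → Fin d → Fin d → ℝ)
    (hc : ∀ k i j, c k i j = - c k j i)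
    (X : Fin d → B)
    (hXstar : ∀ k, star (X k) = - X k)
    (hXlie : ∀ i j, X i * X j - X j * X i = ∑ k : Fin d, (c k i j : ℂ) • X k)
    (A Y : B) (hA : A = 1 - ∑ k : Fin d, X k ^ 2)
    (hAY : A * Y = 1) (hYA : Y * A = 1) :
    ∀ n : ℕ, 1 ≤ n → ∀ k : Fin (4 * n) → Fin (d + 1),
      Y ^ n * (List.ofFn fun i => extX X (k i)).prod * Y ^ n
          - (List.ofFn fun i : Fin (2 * n) =>
              Ymat X Y (k ⟨2 * i.val, by omega⟩) (k ⟨2 * i.val + 1, by omega⟩)).prod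
        ∈ scriptX0 X Y := by
  intro n _ k
  have hV := commutator_extX_mem hXlie hA
  have hY := star_resolvent hXstar hA hYA
  let L : List (Fin (d + 1) × Fin (d + 1)) := List.ofFn fun i : Fin (2 * n) =>
    (k ⟨2 * i.val, by omega⟩, k ⟨2 * i.val + 1, by omega⟩)
  have hL : L.length = 2 * n := List.length_ofFn
  have hprod : (List.ofFn fun i => extX X (k i)).prod = pairProd X L := by
    rw [List.ofFn_congr (show 4 * n = 2 * (2 * n) by ring), List.ofFn_mul', List.prod_flatten]
    simp [pairProd, L, List.map_ofFn, Function.comp_def, List.ofFn_succ]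
  have hprodY : (List.ofFn fun i : Fin (2 * n) =>
      Ymat X Y (k ⟨2 * i.val, by omega⟩) (k ⟨2 * i.val + 1, by omega⟩)).prod =
        pairProdY X Y L := by
    simp [pairProdY, L, List.map_ofFn, Function.comp_def]
  rw [hprod, hprodY, ← List.take_append_drop n L]
  have h1 := pow_mul_pairProd_congr hXstar hY hV hAY hYA (L.take n)
  have h2 := pairProd_mul_pow_congr hV hAY hYA (L.drop n)
  rw [List.length_take, hL, min_eq_left (by omega)] at h1
  rw [List.length_drop, hL, show 2 * n - n = n by omega] at h2
  have hm : pairProd X (L.drop n) * Y ^ n ∈ scriptX X Y := by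
    simpa using add_mem (scriptX0_subset_scriptX h2) (pairProdY_mem_scriptX (L.drop n))
  have h := add_mem (mul_mem_scriptX0_right hm h1)
    (mul_mem_scriptX0_left (pairProdY_mem_scriptX (L.take n)) h2)
  rw [sub_mul, mul_sub, sub_add_sub_cancel] at h
  have hsplit : pairProd X (L.take n ++ L.drop n) =
      pairProd X (L.take n) * pairProd X (L.drop n) := by
    simp only [pairProd, List.map_append, List.prod_append]
  have hsplitY : pairProdY X Y (L.take n ++ L.drop n) =
      pairProdY X Y (L.take n) * pairProdY X Y (L.drop n) := by
    simp only [pairProdY, List.map_append, List.prod_append]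
  rw [hsplit, hsplitY]
  simpa only [mul_assoc] using h
end
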